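/- arXiv:1311.5963 — 4 statements merged into one kernel-verified Lean document; each statement's English description precedes it below -/
import Mathlib

section
/- For every i ∈ {0,…,n} there exists E ∈ ℕ such that for all e ≥ E, Hom_{kG}(V_i, S/𝔪^{[p^e]}) ≠ 0; equivalently, each M_i appears as a direct summand of ᵉR for all sufficiently large e. -/
/-!
For every `i` there exists `E` such that for all `e ≥ E` we have
`Hom_{kG}(V_i, S/𝔪^{[p^e]}) ≠ 0` (equivalently, `M_i` is a direct summand of `ᵉR` for all
sufficiently large `e`).  Setting: `k` algebraically closed of characteristic `p > 0`,
`S = k[x_1, …, x_d]`, `G ⊆ GL(V)` finite, acting on `S` by `k`-algebra automorphisms induced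
by a linear action on `V = ⟨x_1, …, x_d⟩`, with `p ∤ |G|`; `V_0 = k, V_1, …, V_n` a complete
set of pairwise non-isomorphic irreducible `kG`-modules.
-/

set_option linter.unusedSectionVars false
set_option synthInstance.maxHeartbeats 1000000
set_option maxHeartbeats 1600000

open MvPolynomial TensorProduct

section Defs

variable (k : Type) [Field k] (p d : ℕ) [Fact p.Prime] [CharP k p]
variable (G : Type) [Group G] [Fintype G]
variable [MulSemiringAction G (MvPolynomial (Fin d) k)]
variable [SMulCommClass G k (MvPolynomial (Fin d) k)]

/-- The Frobenius power `𝔪^{[q]} = (x_1^q, …, x_d^q)` with `q = p^e`. -/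
noncomputable def frobPowIdeal (e : ℕ) : Ideal (MvPolynomial (Fin d) k) :=
  Ideal.span (Set.range fun j : Fin d => (X j : MvPolynomial (Fin d) k) ^ p ^ e)

theorem pow_mem_frobPowIdeal (e : ℕ) (v : MvPolynomial (Fin d) k)
    (hv : v ∈ Submodule.span k (Set.range X)) :
    v ^ p ^ e ∈ frobPowIdeal k p d e := by
  induction hv using Submodule.span_induction with
  | mem x hx =>
      obtain ⟨j, rfl⟩ := hx
      exact Ideal.subset_span ⟨j, rfl⟩
  | zero =>
      rw [zero_pow (pow_ne_zero e (Fact.out : p.Prime).ne_zero)]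
      exact zero_mem _
  | add x y _ _ hx hy =>
      rw [add_pow_char_pow]
      exact add_mem hx hy
  | smul c x _ hx =>
      rw [smul_pow, MvPolynomial.smul_eq_C_mul]
      exact Ideal.mul_mem_left _ _ hx

theorem smul_mem_frobPowIdeal
    (hlin : ∀ (g : G) (j : Fin d),
      g • (X j : MvPolynomial (Fin d) k) ∈ Submodule.span k (Set.range X))
    (e : ℕ) (g : G) (x : MvPolynomial (Fin d) k) (hx : x ∈ frobPowIdeal k p d e) :
    g • x ∈ frobPowIdeal k p d e := by
  have : g • x = MulSemiringAction.toRingHom G (MvPolynomial (Fin d) k) g x := rfl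
  rw [this]
  have h2 : Ideal.map (MulSemiringAction.toRingHom G (MvPolynomial (Fin d) k) g)
      (frobPowIdeal k p d e) ≤ frobPowIdeal k p d e := by
    rw [frobPowIdeal, Ideal.map_span]
    apply Ideal.span_le.2
    rintro y ⟨z, ⟨j, rfl⟩, rfl⟩
    simp only [map_pow]
    exact pow_mem_frobPowIdeal k p d e _ (hlin g j)
  exact h2 (Ideal.mem_map_of_mem _ hx)

/-- `S/𝔪^{[q]}` as a `k`-vector space. -/
def frobQuot (e : ℕ) : Type :=
  MvPolynomial (Fin d) k ⧸ (Submodule.restrictScalars k (frobPowIdeal k p d e))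

noncomputable instance (e : ℕ) : AddCommGroup (frobQuot k p d e) :=
  inferInstanceAs (AddCommGroup (MvPolynomial (Fin d) k ⧸
    (Submodule.restrictScalars k (frobPowIdeal k p d e))))

noncomputable instance (e : ℕ) : Module k (frobQuot k p d e) :=
  inferInstanceAs (Module k (MvPolynomial (Fin d) k ⧸
    (Submodule.restrictScalars k (frobPowIdeal k p d e))))

/-- The `k`-linear endomorphism of `S/𝔪^{[q]}` induced by the action of `g ∈ G`. -/
noncomputable def frobQuotAction
    (hlin : ∀ (g : G) (j : Fin d),
      g • (X j : MvPolynomial (Fin d) k) ∈ Submodule.span k (Set.range X))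
    (e : ℕ) (g : G) : frobQuot k p d e →ₗ[k] frobQuot k p d e :=
  Submodule.mapQ _ _ (DistribMulAction.toLinearMap k _ g)
    (fun x hx => smul_mem_frobPowIdeal k p d G hlin e g x hx)

variable (W : Type) [AddCommGroup W] [Module k W] [DistribMulAction G W] [SMulCommClass G k W]

/-- `Hom_{kG}(W, S/𝔪^{[p^e]})`: the space of `G`-equivariant `k`-linear maps. -/
def equivariantHom
    (hlin : ∀ (g : G) (j : Fin d),
      g • (X j : MvPolynomial (Fin d) k) ∈ Submodule.span k (Set.range X))
    (e : ℕ) : Submodule k (W →ₗ[k] frobQuot k p d e) where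
  carrier := {f | ∀ (g : G) (w : W), f (g • w) = frobQuotAction k p d G hlin e g (f w)}
  add_mem' := by
    intro f f' hf hf' g w
    simp [hf g w, hf' g w]
  zero_mem' := by intro g w; simp
  smul_mem' := by
    intro c f hf g w
    simp [hf g w]

/-- Irreducibility of a representation of `G` over `k`. -/
def IsIrreducibleRep (M : Type) [AddCommGroup M] [Module k M] [DistribMulAction G M]
    [SMulCommClass G k M] : Prop :=
  Nontrivial M ∧
    ∀ N : Submodule k M, (∀ g : G, ∀ x ∈ N, g • x ∈ N) → N = ⊥ ∨ N = ⊤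

/-- `G`-equivariant `k`-linear isomorphy of representations. -/
def IsRepIso (M M' : Type) [AddCommGroup M] [Module k M] [DistribMulAction G M]
    [SMulCommClass G k M] [AddCommGroup M'] [Module k M'] [DistribMulAction G M']
    [SMulCommClass G k M'] : Prop :=
  ∃ φ : M ≃ₗ[k] M', ∀ (g : G) (x : M), φ (g • x) = g • φ x

end Defs

theorem aux_not_mem_frobPowIdeal (k : Type) [Field k] (p d : ℕ) (e : ℕ)
    (F : MvPolynomial (Fin d) k) (hF : F ≠ 0) (hd : F.totalDegree < p ^ e) :
    F ∉ frobPowIdeal k p d e := by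
  intro hmem
  have h1 : frobPowIdeal k p d e = Ideal.span ((fun s => monomial s (1 : k)) ''
      (Set.range fun j : Fin d => Finsupp.single j (p ^ e))) := by
    rw [frobPowIdeal, ← Set.range_comp]
    congr 2
    funext j
    simp [X_pow_eq_monomial]
  rw [h1, mem_ideal_span_monomial_image] at hmem
  obtain ⟨m, hm⟩ := (MvPolynomial.support_nonempty (p := F)).2 hF
  obtain ⟨_, ⟨j, rfl⟩, hj⟩ := hmem m hm
  have h2 : p ^ e ≤ m j := by simpa using hj j
  have h3 : m.sum (fun _ n => n) ≤ F.totalDegree := le_totalDegree hm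
  have h4 : m j ≤ m.sum (fun _ n => n) := by
    rw [Finsupp.sum_fintype _ _ (fun _ => rfl)]
    exact Finset.single_le_sum (f := fun i => m i) (fun _ _ => Nat.zero_le _) (Finset.mem_univ j)
  omega

theorem aux_exists_map (k : Type) [Field k] (d : ℕ) (G : Type) [Group G] [Fintype G]
    [MulSemiringAction G (MvPolynomial (Fin d) k)]
    [SMulCommClass G k (MvPolynomial (Fin d) k)]
    (hfaithful : ∀ g : G, (∀ s : MvPolynomial (Fin d) k, g • s = s) → g = 1)
    (W : Type) [AddCommGroup W] [Module k W] [DistribMulAction G W] [SMulCommClass G k W]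
    [Nontrivial W] :
    ∃ (f : W →ₗ[k] MvPolynomial (Fin d) k) (w : W),
      (∀ (g : G) (x : W), f (g • x) = g • f x) ∧ f w ≠ 0 := by
  obtain ⟨w, hw⟩ := exists_ne (0 : W)
  obtain ⟨l, hl⟩ : ∃ l : Module.Dual k W, l w ≠ 0 := by
    by_contra! h
    exact hw ((Module.forall_dual_apply_eq_zero_iff k w).1 h)
  let φ : G → (MvPolynomial (Fin d) k →* MvPolynomial (Fin d) k) :=
    fun g => (MulSemiringAction.toRingHom G (MvPolynomial (Fin d) k) g : _ →* _)
  have hφ : ∀ g s, φ g s = g • s := fun _ _ => rfl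
  have hinj : Function.Injective φ := by
    intro g h hgh
    have : h⁻¹ * g = 1 := hfaithful _ fun s => by
      rw [mul_smul, ← hφ g, hgh, hφ, inv_smul_smul]
    exact (inv_mul_eq_one.1 this).symm
  have hli := (linearIndependent_monoidHom (MvPolynomial (Fin d) k)
    (MvPolynomial (Fin d) k)).comp φ hinj
  rw [Fintype.linearIndependent_iff] at hli
  obtain ⟨s, hs⟩ : ∃ s : MvPolynomial (Fin d) k, ∑ g : G, l (g⁻¹ • w) • (g • s) ≠ 0 := by
    by_contra! h
    have := hli (fun g => C (l (g⁻¹ • w))) (by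
      funext s
      have h' := h s
      simpa [Finset.sum_apply, hφ, smul_eq_C_mul] using h') 1
    simp at this
    exact hl this
  refine ⟨∑ g : G, (l.comp (DistribSMul.toLinearMap k W g⁻¹)).smulRight (g • s), w, ?_, ?_⟩
  · intro h x
    simp only [LinearMap.sum_apply, LinearMap.smulRight_apply, LinearMap.comp_apply,
      DistribSMul.toLinearMap_apply, Finset.smul_sum]
    rw [← Equiv.sum_comp (Equiv.mulLeft h)]
    refine Finset.sum_congr rfl fun g _ => ?_
    simp only [Equiv.coe_mulLeft, mul_inv_rev, mul_smul, inv_smul_smul]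
    rw [smul_comm h (l (g⁻¹ • x))]
  · simpa [LinearMap.sum_apply] using hs

theorem equivariantHom_ne_bot_of_large_e
    (k : Type) [Field k] [IsAlgClosed k] (p : ℕ) [Fact p.Prime] [CharP k p]
    (d n : ℕ) (G : Type) [Group G] [Fintype G]
    [MulSemiringAction G (MvPolynomial (Fin d) k)]
    [SMulCommClass G k (MvPolynomial (Fin d) k)]
    -- the order of `G` is not divisible by `p`
    (hord : ¬ p ∣ Fintype.card G)
    -- the action of `G` on `S` is induced by a linear action on `V = ⟨x_1, …, x_d⟩`
    (hlin : ∀ (g : G) (j : Fin d),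
      g • (X j : MvPolynomial (Fin d) k) ∈ Submodule.span k (Set.range X))
    -- `G ⊆ GL(V)`: the action is faithful
    (hfaithful : ∀ g : G, (∀ s : MvPolynomial (Fin d) k, g • s = s) → g = 1)
    -- `V_0 = k, V_1, …, V_n`: a complete set of pairwise non-isomorphic irreducible
    -- representations of `G` over `k`, with `V_0` the trivial one-dimensional representation
    (W : Fin (n + 1) → Type) [∀ i, AddCommGroup (W i)] [∀ i, Module k (W i)]
    [∀ i, DistribMulAction G (W i)] [∀ i, SMulCommClass G k (W i)]
    (hirr : ∀ i, IsIrreducibleRep k G (W i))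
    (hdist : ∀ i j, i ≠ j → ¬ IsRepIso k G (W i) (W j))
    (hcomplete : ∀ (P : Type) [AddCommGroup P] [Module k P] [DistribMulAction G P]
      [SMulCommClass G k P], IsIrreducibleRep k G P → ∃ i, IsRepIso k G P (W i))
    (htriv : Module.finrank k (W 0) = 1 ∧ ∀ (g : G) (x : W 0), g • x = x) :
    ∀ i : Fin (n + 1), ∃ E : ℕ, ∀ e : ℕ, E ≤ e →
      equivariantHom k p d G (W i) hlin e ≠ ⊥ := by
  intro i
  haveI := (hirr i).1
  obtain ⟨f, w, hf, hw⟩ := aux_exists_map k d G hfaithful (W i)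
  refine ⟨(f w).totalDegree, fun e he hbot => ?_⟩
  have hlt : (f w).totalDegree < p ^ e :=
    lt_of_le_of_lt he (Nat.lt_pow_self (Fact.out : p.Prime).one_lt)
  let F : W i →ₗ[k] frobQuot k p d e :=
    (Submodule.mkQ (Submodule.restrictScalars k (frobPowIdeal k p d e))).comp f
  have hF : F ∈ equivariantHom k p d G (W i) hlin e := by
    intro g x
    change Submodule.mkQ (Submodule.restrictScalars k (frobPowIdeal k p d e)) (f (g • x)) = _
    rw [hf]
    rfl
  rw [hbot, Submodule.mem_bot] at hF
  have h0 : Submodule.mkQ (Submodule.restrictScalars k (frobPowIdeal k p d e)) (f w) = 0 :=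
    LinearMap.congr_fun hF w
  rw [Submodule.mkQ_apply, Submodule.Quotient.mk_eq_zero] at h0
  exact aux_not_mem_frobPowIdeal k p d e (f w) hw hlt h0
end

section
/- Let N be a finitely generated reflexive R-module. Let G act on the S-module S ⊗_R N by g • (s ⊗ n) = (g s) ⊗ n (well defined since G fixes R pointwise), and let G act on the S-dual Hom_S(P, S) of any S-module P carrying such a compatible G-action by (g • f)(x) = g • (f(g^{-1} • x)). Let λ : S ⊗_R N → (S ⊗_R N)^{**} be the canonical evaluation map into the double S-dual. Then the map u : N → ((S ⊗_R N)^{**})^G given by u(n) = λ(1 ⊗ n) is an isomorphism of R-modules. -/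
/-!
Setting: `k` algebraically closed of characteristic `p > 0`, `S = k[x_1, …, x_d]`,
`G ⊆ GL(V)` finite with `p ∤ |G|` and no pseudo-reflections, acting on `S` by `k`-algebra
automorphisms induced by a linear action on `V = ⟨x_1, …, x_d⟩`; `R = S^G`.
For a finitely generated reflexive `R`-module `N`, with `G` acting on `S ⊗_R N` by
`g • (s ⊗ n) = (g s) ⊗ n` and on `S`-duals by `(g • f)(x) = g • f(g⁻¹ • x)`, the unit map
`u : N → ((S ⊗_R N)^{**})^G`, `u(n) = λ(1 ⊗ n)` (with `λ` the canonical evaluation into the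
double `S`-dual), is an isomorphism of `R`-modules.
-/

set_option linter.unusedSectionVars false
set_option synthInstance.maxHeartbeats 1000000
set_option maxHeartbeats 1600000

open MvPolynomial TensorProduct

section Defs

variable (k : Type) [Field k] (d : ℕ) (G : Type) [Group G] [Fintype G]
variable [MulSemiringAction G (MvPolynomial (Fin d) k)]
variable [SMulCommClass G k (MvPolynomial (Fin d) k)]

def invariantSubalgebra : Subalgebra k (MvPolynomial (Fin d) k) where
  carrier := MulAction.fixedPoints G (MvPolynomial (Fin d) k)
  mul_mem' := by
    intro a b ha hb g
    rw [smul_mul', ha g, hb g]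
  add_mem' := by
    intro a b ha hb g
    rw [smul_add, ha g, hb g]
  algebraMap_mem' := by
    intro c g
    rw [Algebra.algebraMap_eq_smul_one, smul_comm, smul_one]

variable (N : Type) [AddCommGroup N] [Module (invariantSubalgebra k d G) N]

/-- `g : S → S` is `R`-linear since `G` fixes `R` pointwise. -/
noncomputable def smulRLinear (g : G) :
    MvPolynomial (Fin d) k →ₗ[invariantSubalgebra k d G] MvPolynomial (Fin d) k where
  toFun := fun s => g • s
  map_add' := fun a b => smul_add g a b
  map_smul' := by
    intro r s
    show g • (r • s) = r • (g • s)
    rw [Algebra.smul_def, Algebra.smul_def, smul_mul']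
    congr 1
    rw [Subalgebra.algebraMap_eq]
    exact r.2 g

/-- The action of `g ∈ G` on `S ⊗_R N`, `g • (s ⊗ n) = (g s) ⊗ n`. -/
noncomputable def tensorAct (g : G) :
    (MvPolynomial (Fin d) k ⊗[invariantSubalgebra k d G] N) →ₗ[invariantSubalgebra k d G]
      (MvPolynomial (Fin d) k ⊗[invariantSubalgebra k d G] N) :=
  TensorProduct.map (smulRLinear k d G g) LinearMap.id

theorem tensorAct_smul (g : G) (s : MvPolynomial (Fin d) k)
    (x : MvPolynomial (Fin d) k ⊗[invariantSubalgebra k d G] N) :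
    tensorAct k d G N g (s • x) = (g • s) • tensorAct k d G N g x := by
  induction x using TensorProduct.induction_on with
  | zero => simp
  | tmul s' n =>
      show (g • (s * s')) ⊗ₜ[invariantSubalgebra k d G] n =
        ((g • s) * (g • s')) ⊗ₜ[invariantSubalgebra k d G] n
      rw [smul_mul']
  | add x y hx hy =>
      simp only [smul_add, map_add, hx, hy]

/-- The action of `g ∈ G` on the `S`-dual of `S ⊗_R N`: `(g • f)(x) = g • f(g⁻¹ • x)`. -/
noncomputable def dualAct (g : G)
    (f : Module.Dual (MvPolynomial (Fin d) k)
      (MvPolynomial (Fin d) k ⊗[invariantSubalgebra k d G] N)) :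
    Module.Dual (MvPolynomial (Fin d) k)
      (MvPolynomial (Fin d) k ⊗[invariantSubalgebra k d G] N) where
  toFun := fun x => g • f (tensorAct k d G N g⁻¹ x)
  map_add' := by
    intro x y
    simp only [map_add, smul_add]
  map_smul' := by
    intro s x
    simp only [RingHom.id_apply, smul_eq_mul]
    rw [tensorAct_smul, map_smul, smul_eq_mul, smul_mul', smul_inv_smul]

theorem dualAct_add (g : G) (f f' : Module.Dual (MvPolynomial (Fin d) k)
    (MvPolynomial (Fin d) k ⊗[invariantSubalgebra k d G] N)) :
    dualAct k d G N g (f + f') = dualAct k d G N g f + dualAct k d G N g f' := by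
  refine LinearMap.ext fun x => ?_
  show g • (f + f') (tensorAct k d G N g⁻¹ x) =
    g • f (tensorAct k d G N g⁻¹ x) + g • f' (tensorAct k d G N g⁻¹ x)
  rw [LinearMap.add_apply, smul_add]

theorem dualAct_smul (g : G) (s : MvPolynomial (Fin d) k)
    (f : Module.Dual (MvPolynomial (Fin d) k)
      (MvPolynomial (Fin d) k ⊗[invariantSubalgebra k d G] N)) :
    dualAct k d G N g (s • f) = (g • s) • dualAct k d G N g f := by
  refine LinearMap.ext fun x => ?_
  show g • (s • f) (tensorAct k d G N g⁻¹ x) =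
    (g • s) • (g • f (tensorAct k d G N g⁻¹ x))
  rw [LinearMap.smul_apply, smul_eq_mul, smul_eq_mul, smul_mul']

/-- The action of `g ∈ G` on the double `S`-dual of `S ⊗_R N`:
`(g • F)(φ) = g • F(g⁻¹ • φ)`. -/
noncomputable def doubleDualAct (g : G)
    (F : Module.Dual (MvPolynomial (Fin d) k) (Module.Dual (MvPolynomial (Fin d) k)
      (MvPolynomial (Fin d) k ⊗[invariantSubalgebra k d G] N))) :
    Module.Dual (MvPolynomial (Fin d) k) (Module.Dual (MvPolynomial (Fin d) k)
      (MvPolynomial (Fin d) k ⊗[invariantSubalgebra k d G] N)) where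
  toFun := fun φ => g • F (dualAct k d G N g⁻¹ φ)
  map_add' := by
    intro φ ψ
    simp only [dualAct_add, map_add, smul_add]
  map_smul' := by
    intro s φ
    simp only [RingHom.id_apply, smul_eq_mul]
    rw [dualAct_smul, map_smul, smul_eq_mul, smul_mul', smul_inv_smul]

/-- The invariants `((S ⊗_R N)^{**})^G` as an `R`-submodule of the double dual. -/
noncomputable def doubleDualInvariants :
    Submodule (invariantSubalgebra k d G)
      (Module.Dual (MvPolynomial (Fin d) k) (Module.Dual (MvPolynomial (Fin d) k)
        (MvPolynomial (Fin d) k ⊗[invariantSubalgebra k d G] N))) where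
  carrier := {F | ∀ g : G, doubleDualAct k d G N g F = F}
  add_mem' := by
    intro F F' hF hF' g
    refine LinearMap.ext fun φ => ?_
    show g • (F + F') (dualAct k d G N g⁻¹ φ) = (F + F') φ
    conv_rhs => rw [← hF g, ← hF' g]
    rw [LinearMap.add_apply, smul_add]
    rfl
  zero_mem' := by
    intro g
    refine LinearMap.ext fun φ => ?_
    show g • (0 : MvPolynomial (Fin d) k) = 0
    rw [smul_zero]
  smul_mem' := by
    intro r F hF g
    refine LinearMap.ext fun φ => ?_
    show g • (r • F) (dualAct k d G N g⁻¹ φ) = (r • F) φ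
    have h : (r • F) = (r : MvPolynomial (Fin d) k) • F := rfl
    rw [h, LinearMap.smul_apply, LinearMap.smul_apply, smul_eq_mul, smul_eq_mul, smul_mul',
      r.2 g]
    congr 1
    calc g • F (dualAct k d G N g⁻¹ φ) = doubleDualAct k d G N g F φ := rfl
    _ = F φ := by rw [hF g]

/-- The map `u : N → ((S ⊗_R N)^{**})^G`, `u(n) = λ(1 ⊗ n)`, where
`λ : S ⊗_R N → (S ⊗_R N)^{**}` is the canonical evaluation into the double dual. -/
noncomputable def counitUnit :
    N →ₗ[invariantSubalgebra k d G] doubleDualInvariants k d G N where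
  toFun := fun nn =>
    ⟨Module.Dual.eval (MvPolynomial (Fin d) k)
        (MvPolynomial (Fin d) k ⊗[invariantSubalgebra k d G] N)
        ((1 : MvPolynomial (Fin d) k) ⊗ₜ nn),
      by
        intro g
        refine LinearMap.ext fun φ => ?_
        show g • (dualAct k d G N g⁻¹ φ) ((1 : MvPolynomial (Fin d) k) ⊗ₜ nn) =
          φ ((1 : MvPolynomial (Fin d) k) ⊗ₜ nn)
        show g • (g⁻¹ • φ (tensorAct k d G N g⁻¹⁻¹ ((1 : MvPolynomial (Fin d) k) ⊗ₜ nn))) =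
          φ ((1 : MvPolynomial (Fin d) k) ⊗ₜ nn)
        rw [smul_inv_smul, inv_inv]
        have h1 : tensorAct k d G N g
            ((1 : MvPolynomial (Fin d) k) ⊗ₜ[invariantSubalgebra k d G] nn)
            = (1 : MvPolynomial (Fin d) k) ⊗ₜ[invariantSubalgebra k d G] nn := by
          have h2 : tensorAct k d G N g
              ((1 : MvPolynomial (Fin d) k) ⊗ₜ[invariantSubalgebra k d G] nn)
              = (g • (1 : MvPolynomial (Fin d) k)) ⊗ₜ[invariantSubalgebra k d G] nn :=
            TensorProduct.map_tmul _ _ _ _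
          rw [h2, smul_one]
        rw [h1]⟩
  map_add' := by
    intro a b
    apply Subtype.ext
    show Module.Dual.eval _ _ ((1 : MvPolynomial (Fin d) k) ⊗ₜ (a + b)) = _
    rw [TensorProduct.tmul_add, map_add]
    rfl
  map_smul' := by
    intro r nn
    apply Subtype.ext
    show Module.Dual.eval (MvPolynomial (Fin d) k)
        (MvPolynomial (Fin d) k ⊗[invariantSubalgebra k d G] N)
        ((1 : MvPolynomial (Fin d) k) ⊗ₜ (r • nn)) =
      (r : MvPolynomial (Fin d) k) •
        Module.Dual.eval (MvPolynomial (Fin d) k)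
          (MvPolynomial (Fin d) k ⊗[invariantSubalgebra k d G] N)
          ((1 : MvPolynomial (Fin d) k) ⊗ₜ nn)
    have h1 : (1 : MvPolynomial (Fin d) k) ⊗ₜ[invariantSubalgebra k d G] (r • nn) =
        (r : MvPolynomial (Fin d) k) • ((1 : MvPolynomial (Fin d) k)
          ⊗ₜ[invariantSubalgebra k d G] nn) := by
      rw [← TensorProduct.smul_tmul, TensorProduct.smul_tmul']
      congr 1
    rw [h1, map_smul]

end Defs

theorem aux_rank {R N : Type} [CommRing R] [IsDomain R] [AddCommGroup N] [Module R N]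
    [Module.Finite R N] : ∃ r : R, r ≠ 0 ∧ ∃ (m : Type) (_ : Fintype m) (e : m → N)
      (c : m → Module.Dual R N), ∀ n, r • n = ∑ i, c i n • e i := by
  classical
  obtain ⟨m, v, hv⟩ := Module.Finite.exists_fin (R := R) (M := N)
  obtain ⟨s, hs, hmax⟩ := exists_maximal_linearIndepOn R v
  have h1 : ∀ i, ∃ a : R, a ≠ 0 ∧ a • v i ∈ Submodule.span R (v '' s) := by
    intro i
    by_cases hi : i ∈ s
    · exact ⟨1, one_ne_zero, by
        rw [one_smul]; exact Submodule.subset_span ⟨i, hi, rfl⟩⟩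
    · exact hmax i hi
  choose a ha0 ha using h1
  have hr : ∀ n : N, (∏ i, a i) • n ∈ Submodule.span R (Set.range fun i : s => v i) := by
    intro n
    have hn : n ∈ Submodule.span R (Set.range v) := by rw [hv]; trivial
    have himg : (Set.range fun i : s => v i) = v '' s := by
      ext x; simp
    rw [himg]
    induction hn using Submodule.span_induction with
    | mem x hx =>
      obtain ⟨i, rfl⟩ := hx
      rw [← Finset.prod_erase_mul _ _ (Finset.mem_univ i), mul_smul]
      exact Submodule.smul_mem _ _ (ha i)
    | zero => simp
    | add x y _ _ hx hy => rw [smul_add]; exact Submodule.add_mem _ hx hy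
    | smul t x _ hx => rw [smul_comm]; exact Submodule.smul_mem _ _ hx
  refine ⟨∏ i, a i, Finset.prod_ne_zero_iff.mpr fun i _ => ha0 i, s, inferInstance,
    fun i => v i, fun i => (Finsupp.lapply i) ∘ₗ (LinearIndependent.repr hs) ∘ₗ
      (LinearMap.codRestrict _ (LinearMap.lsmul R N (∏ i, a i)) hr), fun n => ?_⟩
  have := hs.linearCombination_repr ⟨_, hr n⟩
  rw [Finsupp.linearCombination_apply, Finsupp.sum_fintype _ _ (by simp)] at this
  exact this.symm

theorem unit_map_bijective
    (k : Type) [Field k] [IsAlgClosed k] (p : ℕ) [Fact p.Prime] [CharP k p]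
    (d : ℕ) (G : Type) [Group G] [Fintype G]
    [MulSemiringAction G (MvPolynomial (Fin d) k)]
    [SMulCommClass G k (MvPolynomial (Fin d) k)]
    -- the order of `G` is not divisible by `p`
    (hord : ¬ p ∣ Fintype.card G)
    -- the action of `G` on `S` is induced by a linear action on `V = ⟨x_1, …, x_d⟩`
    (hlin : ∀ (g : G) (j : Fin d),
      g • (X j : MvPolynomial (Fin d) k) ∈ Submodule.span k (Set.range X))
    -- `G ⊆ GL(V)`: the action is faithful
    (hfaithful : ∀ g : G, (∀ s : MvPolynomial (Fin d) k, g • s = s) → g = 1)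
    -- `G` contains no pseudo-reflections
    (hps : ∀ g : G, g ≠ 1 → Module.finrank k
      (Submodule.span k (Set.range fun j : Fin d =>
        g • (X j : MvPolynomial (Fin d) k) - X j)) ≠ 1)
    -- `N` is a finitely generated reflexive `R`-module
    (N : Type) [AddCommGroup N] [Module (invariantSubalgebra k d G) N]
    [Module.Finite (invariantSubalgebra k d G) N]
    [Module.IsReflexive (invariantSubalgebra k d G) N] :
    Function.Bijective (counitUnit k d G N) := by
  classical
  have hdual : ∀ φ : Module.Dual (invariantSubalgebra k d G) N,
      ∃ Φ : Module.Dual (MvPolynomial (Fin d) k)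
        (MvPolynomial (Fin d) k ⊗[invariantSubalgebra k d G] N),
        ∀ s n, Φ (s ⊗ₜ n) = s * (φ n : MvPolynomial (Fin d) k) := by
    intro φ
    refine ⟨LinearMap.liftBaseChange (MvPolynomial (Fin d) k)
      ((Algebra.linearMap (invariantSubalgebra k d G) (MvPolynomial (Fin d) k)) ∘ₗ φ), ?_⟩
    intro s n
    rw [LinearMap.liftBaseChange_tmul]
    rfl
  choose E hE using hdual
  have hext : ∀ Φ Ψ : Module.Dual (MvPolynomial (Fin d) k)
        (MvPolynomial (Fin d) k ⊗[invariantSubalgebra k d G] N),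
        (∀ n, Φ (1 ⊗ₜ n) = Ψ (1 ⊗ₜ n)) → Φ = Ψ := by
    intro Φ Ψ h
    refine LinearMap.ext fun x => ?_
    induction x using TensorProduct.induction_on with
    | zero => simp
    | tmul s n =>
      have : s ⊗ₜ[invariantSubalgebra k d G] n = s • ((1 : MvPolynomial (Fin d) k) ⊗ₜ n) := by
        rw [TensorProduct.smul_tmul', smul_eq_mul, mul_one]
      rw [this, map_smul, map_smul, h]
    | add x y hx hy => rw [map_add, map_add, hx, hy]
  constructor
  · intro a b hab
    apply (Module.bijective_dual_eval (invariantSubalgebra k d G) N).1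
    refine LinearMap.ext fun φ => ?_
    have h := LinearMap.congr_fun (congrArg Subtype.val hab) (E φ)
    change E φ (1 ⊗ₜ a) = E φ (1 ⊗ₜ b) at h
    rw [hE, hE, one_mul, one_mul] at h
    exact Subtype.ext h
  · rintro ⟨F, hF⟩
    have hinv : ∀ φ g, dualAct k d G N g (E φ) = E φ := by
      intro φ g
      apply hext
      intro n
      change g • E φ ((g⁻¹ • (1 : MvPolynomial (Fin d) k)) ⊗ₜ n) = _
      rw [hE, hE, smul_one, one_mul]
      exact (φ n).2 g
    have hFE : ∀ φ, F (E φ) ∈ invariantSubalgebra k d G := by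
      intro φ g
      have := LinearMap.congr_fun (hF g) (E φ)
      change g • F (dualAct k d G N g⁻¹ (E φ)) = F (E φ) at this
      rwa [hinv] at this
    let f : Module.Dual (invariantSubalgebra k d G)
        (Module.Dual (invariantSubalgebra k d G) N) :=
      { toFun := fun φ => ⟨F (E φ), hFE φ⟩
        map_add' := by
          intro φ ψ
          have : E (φ + ψ) = E φ + E ψ := by
            apply hext
            intro n
            rw [LinearMap.add_apply, hE, hE, hE]
            simp
          apply Subtype.ext
          change F (E (φ + ψ)) = F (E φ) + F (E ψ)
          rw [this, map_add]
        map_smul' := by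
          intro r φ
          have : E (r • φ) = (r : MvPolynomial (Fin d) k) • E φ := by
            apply hext
            intro n
            rw [LinearMap.smul_apply, hE, hE]
            simp
          apply Subtype.ext
          change F (E (r • φ)) = (r : MvPolynomial (Fin d) k) * F (E φ)
          rw [this, map_smul, smul_eq_mul] }
    obtain ⟨n, hn⟩ := (Module.bijective_dual_eval (invariantSubalgebra k d G) N).2 f
    have hn' : ∀ φ, F (E φ) = E φ (1 ⊗ₜ n) := by
      intro φ
      have := congrArg Subtype.val (LinearMap.congr_fun hn φ)
      change (φ n : MvPolynomial (Fin d) k) = F (E φ) at this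
      rw [← this, hE, one_mul]
    refine ⟨n, Subtype.ext (LinearMap.ext fun Ψ => ?_)⟩
    change Ψ (1 ⊗ₜ n) = F Ψ
    obtain ⟨r, hr, m, _, e, c, hc⟩ := aux_rank (R := invariantSubalgebra k d G) (N := N)
    have hΨ : (r : MvPolynomial (Fin d) k) • Ψ = ∑ i, Ψ (1 ⊗ₜ e i) • E (c i) := by
      apply hext
      intro x
      have h1 : ∀ (t : invariantSubalgebra k d G) (y : N),
          Ψ (1 ⊗ₜ (t • y)) = (t : MvPolynomial (Fin d) k) * Ψ (1 ⊗ₜ y) := by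
        intro t y
        rw [TensorProduct.tmul_smul, ← smul_eq_mul, ← map_smul]
        rfl
      rw [LinearMap.smul_apply, smul_eq_mul, ← h1, hc, TensorProduct.tmul_sum, map_sum,
        LinearMap.sum_apply]
      refine Finset.sum_congr rfl fun i _ => ?_
      rw [h1, LinearMap.smul_apply, hE, one_mul, smul_eq_mul, mul_comm]
    have hr' : (r : MvPolynomial (Fin d) k) ≠ 0 := fun h => hr (Subtype.ext h)
    apply mul_left_cancel₀ hr'
    rw [← smul_eq_mul, ← smul_eq_mul, ← LinearMap.smul_apply, ← map_smul, hΨ, map_sum,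
      LinearMap.sum_apply]
    refine Finset.sum_congr rfl fun i _ => ?_
    rw [LinearMap.smul_apply, map_smul, hn']
end

section
/- Let M be a finitely generated S-module which is reflexive over S (the canonical map M → Hom_S(Hom_S(M, S), S) is bijective), equipped with an action of G by additive automorphisms satisfying g • (s · m) = (g s) · (g • m) for all g ∈ G, s ∈ S, m ∈ M. Then the R-module of invariants M^G is a finitely generated reflexive R-module (the canonical map M^G → Hom_R(Hom_R(M^G, R), R) is bijective). -/
/-!
Setting: `k` algebraically closed of characteristic `p > 0`, `S = k[x_1, …, x_d]`,
`G ⊆ GL(V)` finite with `p ∤ |G|`, acting on `S` by `k`-algebra automorphisms induced by a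
linear action on `V = ⟨x_1, …, x_d⟩`; `R = S^G`.
If `M` is a finitely generated reflexive `S`-module with a compatible `G`-action
(`g • (s · m) = (g s) · (g • m)`), then `M^G` is a finitely generated reflexive `R`-module.
-/

set_option linter.unusedSectionVars false
set_option synthInstance.maxHeartbeats 1000000
set_option maxHeartbeats 1600000

open MvPolynomial

section Defs

variable (k : Type) [Field k] (d : ℕ) (G : Type) [Group G] [Fintype G]
variable [MulSemiringAction G (MvPolynomial (Fin d) k)]
variable [SMulCommClass G k (MvPolynomial (Fin d) k)]

variable (M : Type) [AddCommGroup M] [Module (MvPolynomial (Fin d) k) M]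
variable [DistribMulAction G M]

/-- For a `G`-action on an `S`-module `M` compatible with the `G`-action on `S`
(a `(G,S)`-module structure), the invariants `M^G` form an `R`-submodule of `M`. -/
def fixedSubmodule
    (hcompat : ∀ (g : G) (s : MvPolynomial (Fin d) k) (m : M), g • (s • m) = (g • s) • (g • m)) :
    Submodule (invariantSubalgebra k d G) M where
  carrier := MulAction.fixedPoints G M
  add_mem' := by
    intro a b ha hb g
    rw [smul_add, ha g, hb g]
  zero_mem' := by intro g; rw [smul_zero]
  smul_mem' := by
    intro r x hx g
    have h : (r : MvPolynomial (Fin d) k) • x = r • x := rfl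
    rw [← h, hcompat, r.2 g, hx g]

end Defs

theorem aux_sum {G A : Type} [Group G] [Fintype G] [AddCommGroup A] [DistribMulAction G A]
    (h : G) (a : A) : h • (∑ g : G, g • a) = ∑ g : G, g • a := by
  rw [Finset.smul_sum]
  simp only [smul_smul]
  exact Equiv.sum_comp (Equiv.mulLeft h) (fun g => g • a)

section Helpers

variable {R S G : Type} [CommRing R] [CommRing S] [Algebra R S]

theorem aux_reflexive (h0 : S →ₗ[R] R)
    (hex : ∀ h : S →ₗ[R] R, ∃ s : S, ∀ x, h x = h0 (s * x))
    (hun : ∀ s : S, (∀ x, h0 (s * x) = 0) → s = 0)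
    (M : Type) [AddCommGroup M] [Module S M] [Module R M] [IsScalarTower R S M]
    [Module.IsReflexive S M] : Module.IsReflexive R M := by
  have hun2 : ∀ s t : S, (∀ x, h0 (s * x) = h0 (t * x)) → s = t := by
    intro s t h
    rw [← sub_eq_zero]
    apply hun
    intro x
    rw [sub_mul, map_sub, h, sub_self]
  -- every R-linear functional on M comes from an S-linear one
  have hlift : ∀ u : M →ₗ[R] R, ∃ f : M →ₗ[S] S, ∀ m, u m = h0 (f m) := by
    intro u
    have h1 : ∀ m : M, ∃ s : S, ∀ x : S, u (x • m) = h0 (s * x) := fun m =>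
      hex (u ∘ₗ (LinearMap.toSpanSingleton S M m).restrictScalars R)
    choose f hf using h1
    refine ⟨{ toFun := f, map_add' := ?_, map_smul' := ?_ }, ?_⟩
    · intro m n
      apply hun2
      intro x
      rw [← hf, add_mul, map_add, smul_add, map_add, hf, hf]
    · intro s m
      apply hun2
      intro x
      rw [← hf, smul_smul, hf, RingHom.id_apply, smul_eq_mul]
      congr 1
      ring
    · intro m
      have := hf m 1
      simpa using this
  let T : (M →ₗ[S] S) → (M →ₗ[R] R) := fun f => h0 ∘ₗ f.restrictScalars R
  refine ⟨⟨?_, ?_⟩⟩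
  · rw [← LinearMap.ker_eq_bot, LinearMap.ker_eq_bot']
    intro m hm
    apply (Module.bijective_dual_eval S M).1
    rw [map_zero]
    ext f
    apply hun
    intro x
    have := LinearMap.congr_fun hm (T (x • f))
    simpa [T, mul_comm] using this
  · intro φ
    have h1 : ∀ f : M →ₗ[S] S, ∃ s : S, ∀ x : S, φ (T (x • f)) = h0 (s * x) := by
      intro f
      refine hex (φ ∘ₗ ({ toFun := fun x => T (x • f), map_add' := ?_, map_smul' := ?_ } : S →ₗ[R] (M →ₗ[R] R)))
      · intro x y
        ext m
        simp [T, add_mul]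
      · intro r x
        ext m
        simp [T]
    choose Φ hΦ using h1
    let Φ' : Module.Dual S (Module.Dual S M) :=
      { toFun := Φ
        map_add' := by
          intro f g
          apply hun2
          intro x
          rw [← hΦ, add_mul, map_add, ← hΦ, ← hΦ, ← map_add]
          congr 1
          ext m
          simp [T]
        map_smul' := by
          intro s f
          apply hun2
          intro x
          rw [← hΦ, smul_smul, hΦ, RingHom.id_apply, smul_eq_mul]
          congr 1
          ring }
    obtain ⟨m, hm⟩ := (Module.bijective_dual_eval S M).2 Φ'
    refine ⟨m, ?_⟩
    ext u
    obtain ⟨f, hf⟩ := hlift u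
    have e1 : u = T ((1 : S) • f) := by
      ext m
      simp [T, hf]
    have e2 : f m = Φ f := LinearMap.congr_fun hm f
    rw [Module.Dual.eval_apply, hf, e2]
    conv_rhs => rw [e1, hΦ, mul_one]

theorem aux_norm [Group G] [Fintype G] [MulSemiringAction G S] [Algebra.IsInvariant R S G] (b : S) :
    ∃ (b' : S) (r : R), b * b' = algebraMap R S r ∧ algebraMap R S r = ∏ g : G, g • b := by
  classical
  obtain ⟨r, hr⟩ := Algebra.IsInvariant.isInvariant (A := R) (G := G) (∏ g : G, g • b)
    (fun g => by rw [Finset.smul_prod_perm])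
  refine ⟨∏ g ∈ Finset.univ.erase (1 : G), g • b, r, ?_, hr⟩
  rw [hr, ← Finset.mul_prod_erase _ _ (Finset.mem_univ (1 : G)), one_smul]

variable [IsDomain R] [IsDomain S] [Module.Finite R S]

theorem aux_rank_s11 (hinj : Function.Injective (algebraMap R S)) (h1 h2 : S →ₗ[R] R) :
    ∃ a b : S, ¬ (a = 0 ∧ b = 0) ∧ ∀ x, h1 (a * x) = h2 (b * x) := by
  by_contra! hcon
  let A : (S × S) →ₗ[R] (S →ₗ[R] R) :=
    { toFun := fun p => h1 ∘ₗ LinearMap.mulLeft R p.1 - h2 ∘ₗ LinearMap.mulLeft R p.2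
      map_add' := by
        intro p q
        ext x
        simp [add_mul]
        ring
      map_smul' := by
        intro r p
        ext x
        simp [mul_sub] }
  have hA : Function.Injective A := by
    rw [← LinearMap.ker_eq_bot, LinearMap.ker_eq_bot']
    rintro ⟨a, b⟩ hab
    by_contra hne
    obtain ⟨x, hx⟩ := hcon a b (by simpa using hne)
    apply hx
    have := LinearMap.congr_fun hab x
    simpa [A, sub_eq_zero] using this
  obtain ⟨s, hs, hli⟩ := exists_set_linearIndependent R S
  have hq : Module.rank R (S ⧸ Submodule.span R s) = 0 := by
    have h3 := Submodule.rank_quotient_add_rank (Submodule.span R s)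
    have h4 : Module.rank R (Submodule.span R s) = Module.rank R S := by
      rw [← hs]
      exact rank_span_set hli
    rw [h4] at h3
    have hfin := Module.rank_lt_aleph0 R S
    exact Cardinal.eq_of_add_eq_add_right (h3.trans (zero_add _).symm) hfin
  rw [rank_eq_zero_iff] at hq
  let B : (S →ₗ[R] R) →ₗ[R] (s → R) := LinearMap.pi fun i => LinearMap.applyₗ (i : S)
  have hB : Function.Injective B := by
    rw [← LinearMap.ker_eq_bot, LinearMap.ker_eq_bot']
    intro h hh
    ext x
    obtain ⟨r, hr, hrx⟩ := hq (Submodule.Quotient.mk x)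
    rw [← Submodule.Quotient.mk_smul, Submodule.Quotient.mk_eq_zero] at hrx
    have hle : Submodule.span R s ≤ LinearMap.ker h := by
      rw [Submodule.span_le]
      intro y hy
      exact congrFun hh ⟨y, hy⟩
    have : h (r • x) = 0 := hle hrx
    rw [map_smul, smul_eq_mul] at this
    simpa [hr] using this
  have hle := LinearMap.rank_le_of_injective (B ∘ₗ A) (hB.comp hA)
  have hfin := Module.rank_lt_aleph0 R S
  have : Finite s := by
    rw [← Cardinal.lt_aleph0_iff_finite, hs]; exact hfin
  have := Fintype.ofFinite s
  have hge := (linearIndependent_inl_union_inr' hli hli).cardinal_le_rank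
  rw [Cardinal.mk_sum, Cardinal.lift_id, hs] at hge
  rw [rank_fun', ← Cardinal.mk_fintype, hs] at hle
  replace hle := hge.trans hle
  obtain ⟨n, hn⟩ := Cardinal.lt_aleph0.1 hfin
  rw [hn] at hle
  have hn0 : n = 0 := by
    norm_cast at hle
    omega
  rw [hn0, Nat.cast_zero, rank_eq_zero_iff] at hn
  obtain ⟨a, ha, ha1⟩ := hn 1
  apply ha
  apply hinj
  rw [map_zero, ← ha1, Algebra.smul_def, mul_one]

theorem aux_tf (G : Type) [Group G] [Fintype G] [MulSemiringAction G S] [Algebra.IsInvariant R S G]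
    (h : S →ₗ[R] R) (s : S) (hs : s ≠ 0)
    (hh : ∀ x, h (s * x) = 0) : h = 0 := by
  obtain ⟨s', r, h1, h2⟩ := aux_norm (R := R) (G := G) s
  have hr : r ≠ 0 := by
    rintro rfl
    rw [map_zero, eq_comm, Finset.prod_eq_zero_iff] at h2
    obtain ⟨g, -, hg⟩ := h2
    exact hs ((smul_eq_zero_iff_eq g).1 hg)
  ext x
  have := hh (s' * x)
  rw [← mul_assoc, h1, ← Algebra.smul_def, map_smul, smul_eq_mul] at this
  simpa [hr] using this

theorem aux_desc (G : Type) [Group G] [Fintype G] [MulSemiringAction G S] [SMulCommClass G R S]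
    [Algebra.IsInvariant R S G] (n z : R) (hn : algebraMap R S n ≠ 0)
    (h : algebraMap R S n ∣ algebraMap R S z) : ∃ e : R, algebraMap R S z = algebraMap R S n * algebraMap R S e := by
  obtain ⟨x, hx⟩ := h
  obtain ⟨e, rfl⟩ := Algebra.IsInvariant.isInvariant (A := R) (G := G) x (fun g => by
    apply mul_left_cancel₀ hn
    rw [← hx]
    have := congrArg (g • ·) hx
    simp only [smul_mul', smul_algebraMap] at this
    exact this.symm)
  exact ⟨e, hx⟩

theorem aux_div (G : Type) [Group G] [Fintype G] [MulSemiringAction G S] [SMulCommClass G R S]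
    [Algebra.IsInvariant R S G] [UniqueFactorizationMonoid S]
    (hinj : Function.Injective (algebraMap R S)) (h1 h2 : S →ₗ[R] R) (a b : S)
    (hb : b ≠ 0) (hab : IsRelPrime a b) (hrel : ∀ x, h1 (a * x) = h2 (b * x)) :
    ∃ e : S →ₗ[R] R, ∀ x, h1 x = e (b * x) := by
  classical
  obtain ⟨b', n, hn, hn2⟩ := aux_norm (R := R) (G := G) b
  have hn0 : algebraMap R S n ≠ 0 := by
    rw [hn2, Finset.prod_ne_zero_iff]
    intro g _ hg
    exact hb ((smul_eq_zero_iff_eq g).1 hg)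
  have hnR : n ≠ 0 := by
    rintro rfl
    exact hn0 (map_zero _)
  have key : ∀ s, algebraMap R S n ∣ algebraMap R S (h1 (b' * s)) := by
    let I : Ideal S :=
      { carrier := {t | ∀ s, algebraMap R S n ∣ algebraMap R S (h1 (b' * (t * s)))}
        add_mem' := by
          intro x y hx hy s
          rw [add_mul, mul_add, map_add, map_add]
          exact dvd_add (hx s) (hy s)
        zero_mem' := by
          intro s
          simp
        smul_mem' := by
          intro c x hx s
          have := hx (c * s)
          rw [smul_eq_mul]
          convert this using 4
          ring }
    have hbI : b ∈ I := by
      intro s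
      rw [← mul_assoc, mul_comm b', hn, ← Algebra.smul_def, map_smul, smul_eq_mul, map_mul]
      exact dvd_mul_right _ _
    have haI : a ∈ I := by
      intro s
      rw [show b' * (a * s) = a * (b' * s) by ring, hrel, ← mul_assoc, hn, ← Algebra.smul_def,
        map_smul, smul_eq_mul, map_mul]
      exact dvd_mul_right _ _
    intro s
    by_contra hnd
    obtain ⟨n', z', c, hrp, e1, e2⟩ :=
      UniqueFactorizationMonoid.exists_reduced_factors (algebraMap R S n) hn0
        (algebraMap R S (h1 (b' * s)))
    have hc : c ≠ 0 := by
      rintro rfl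
      exact hn0 (by rw [← e1, zero_mul])
    have hn'0 : n' ≠ 0 := by
      rintro rfl
      exact hn0 (by rw [← e1, mul_zero])
    have hnu : ¬ IsUnit n' := by
      intro hu
      apply hnd
      rw [← e1, ← e2]
      exact mul_dvd_mul_left _ hu.dvd
    obtain ⟨π, hπ, hπn⟩ := WfDvdMonoid.exists_irreducible_factor hnu hn'0
    have hπp : Prime π := UniqueFactorizationMonoid.irreducible_iff_prime.1 hπ
    -- invariant elements of I are divisible by π
    have hinvI : ∀ r : R, algebraMap R S r ∈ I → π ∣ algebraMap R S r := by
      intro r hr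
      have h3 := hr s
      rw [show b' * (algebraMap R S r * s) = algebraMap R S r * (b' * s) by ring,
        ← Algebra.smul_def, map_smul, smul_eq_mul, map_mul, ← e1, ← e2,
        show algebraMap R S r * (c * z') = c * (algebraMap R S r * z') by ring] at h3
      have h4 := (mul_dvd_mul_iff_left hc).1 h3
      exact hπn.trans (hrp.dvd_of_dvd_mul_right h4)
    have hprime : ∀ g : G, Prime (g • π) := fun g =>
      (MulEquiv.prime_iff (MulSemiringAction.toRingEquiv G S g)).2 hπp
    have hsub : (I : Set S) ⊆ ⋃ g ∈ ((Finset.univ : Finset G) : Set G),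
        (Ideal.span {g • π} : Ideal S) := by
      intro t ht
      obtain ⟨t', r, h5, h6⟩ := aux_norm (R := R) (G := G) t
      have h7 : π ∣ ∏ g : G, g • t := by
        rw [← h6]
        apply hinvI
        rw [← h5]
        exact I.mul_mem_right _ ht
      obtain ⟨g, -, u, hg⟩ := (hπp.dvd_finsetProd_iff _).1 h7
      simp only [Finset.coe_univ, Set.mem_univ, Set.iUnion_true, Set.mem_iUnion, SetLike.mem_coe,
        Ideal.mem_span_singleton]
      refine ⟨g⁻¹, g⁻¹ • u, ?_⟩
      rw [← smul_mul', ← hg, inv_smul_smul]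
    obtain ⟨g, -, hg⟩ := (Ideal.subset_union_prime (1 : G) 1 (fun g _ _ _ =>
      (Ideal.span_singleton_prime (hprime g).ne_zero).2 (hprime g))).1 hsub
    exact (hprime g).not_isUnit (hab (Ideal.mem_span_singleton.1 (hg haI))
      (Ideal.mem_span_singleton.1 (hg hbI)))
  choose e he using fun s => aux_desc (R := R) G n _ hn0 (key s)
  have he' : ∀ s, h1 (b' * s) = n * e s := fun s => hinj (by rw [he, map_mul])
  refine ⟨{ toFun := e, map_add' := ?_, map_smul' := ?_ }, ?_⟩
  · intro x y
    apply mul_left_cancel₀ hnR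
    rw [← he', mul_add, map_add, mul_add, he', he']
  · intro r x
    apply mul_left_cancel₀ hnR
    rw [← he', mul_smul_comm, map_smul, he', RingHom.id_apply, smul_eq_mul, smul_eq_mul]
    ring
  · intro x
    apply mul_left_cancel₀ hnR
    change _ = n * e (b * x)
    rw [← he', ← mul_assoc, mul_comm b', hn, ← Algebra.smul_def, map_smul, smul_eq_mul]

theorem aux_gen (G : Type) [Group G] [Fintype G] [MulSemiringAction G S] [SMulCommClass G R S]
    [Algebra.IsInvariant R S G] [UniqueFactorizationMonoid S] [IsNoetherianRing R]
    (hinj : Function.Injective (algebraMap R S)) (τ : S →ₗ[R] R) (hτ : τ ≠ 0) :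
    ∃ h0 : S →ₗ[R] R, (∀ h : S →ₗ[R] R, ∃ s : S, ∀ x, h x = h0 (s * x)) ∧
      (∀ s : S, (∀ x, h0 (s * x) = 0) → s = 0) := by
  let P : (S →ₗ[R] R) → Submodule R (S →ₗ[R] R) := fun h =>
    { carrier := {f | ∃ s : S, ∀ x, f x = h (s * x)}
      add_mem' := by
        rintro f g ⟨s, hs⟩ ⟨t, ht⟩
        exact ⟨s + t, fun x => by rw [add_mul, map_add, ← hs, ← ht, LinearMap.add_apply]⟩
      zero_mem' := ⟨0, fun x => by simp⟩
      smul_mem' := by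
        rintro r f ⟨s, hs⟩
        exact ⟨r • s, fun x => by simp [hs]⟩ }
  obtain ⟨_, ⟨h0, h0ne, rfl⟩, hmax⟩ := set_has_maximal_iff_noetherian.2
    (inferInstance : IsNoetherian R (S →ₗ[R] R)) {N | ∃ h, h ≠ 0 ∧ P h = N} ⟨_, τ, hτ, rfl⟩
  refine ⟨h0, ?_, ?_⟩
  · intro h
    by_cases hh : h = 0
    · exact ⟨0, fun x => by simp [hh]⟩
    obtain ⟨a, b, hne, hrel⟩ := aux_rank_s11 hinj h0 h
    have hb0 : b ≠ 0 := by
      rintro rfl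
      refine h0ne (aux_tf G h0 a (fun ha => hne ⟨ha, rfl⟩) fun x => ?_)
      rw [hrel, zero_mul, map_zero]
    obtain ⟨b', a', c, hrp, e1, e2⟩ := UniqueFactorizationMonoid.exists_reduced_factors b hb0 a
    have hc : c ≠ 0 := by
      rintro rfl
      exact hb0 (by rw [← e1, zero_mul])
    have hb' : b' ≠ 0 := by
      rintro rfl
      exact hb0 (by rw [← e1, mul_zero])
    have hrel' : ∀ x, h0 (a' * x) = h (b' * x) := by
      have := aux_tf G (h0 ∘ₗ LinearMap.mulLeft R a' - h ∘ₗ LinearMap.mulLeft R b') c hc (by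
        intro x
        have := hrel x
        rw [← e1, ← e2] at this
        simp only [LinearMap.sub_apply, LinearMap.comp_apply, LinearMap.mulLeft_apply]
        rw [sub_eq_zero, ← mul_assoc, ← mul_assoc, mul_comm a', mul_comm b', this])
      intro x
      have := LinearMap.congr_fun this x
      simpa [sub_eq_zero] using this
    obtain ⟨e, he⟩ := aux_div G hinj h0 h a' b' hb' hrp.symm hrel'
    have hene : e ≠ 0 := by
      rintro rfl
      exact h0ne (by ext x; simp [he])
    have hle : P h0 ≤ P e := by
      rintro f ⟨s, hs⟩
      exact ⟨b' * s, fun x => by rw [hs, he, mul_assoc]⟩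
    have hh : P h0 = P e := by
      by_contra hne
      exact hmax _ ⟨e, hene, rfl⟩ (lt_of_le_of_ne hle hne)
    have hmem : e ∈ P h0 := by
      rw [hh]
      exact ⟨1, fun x => by rw [one_mul]⟩
    obtain ⟨s, hs⟩ := hmem
    refine ⟨s * a', ?_⟩
    have := aux_tf G (h - e ∘ₗ LinearMap.mulLeft R a') b' hb' (by
        intro x
        simp only [LinearMap.sub_apply, LinearMap.comp_apply, LinearMap.mulLeft_apply]
        rw [sub_eq_zero, ← hrel', he]
        congr 1
        ring)
    intro x
    have := LinearMap.congr_fun this x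
    simp only [LinearMap.sub_apply, LinearMap.comp_apply, LinearMap.mulLeft_apply, sub_eq_zero,
      LinearMap.zero_apply] at this
    rw [this, hs, mul_assoc]
  · intro s hs
    by_contra hne
    exact h0ne (aux_tf G h0 s hne hs)

end Helpers

theorem fixedSubmodule_finite_and_reflexive
    (k : Type) [Field k] [IsAlgClosed k] (p : ℕ) [Fact p.Prime] [CharP k p]
    (d : ℕ) (G : Type) [Group G] [Fintype G]
    [MulSemiringAction G (MvPolynomial (Fin d) k)]
    [SMulCommClass G k (MvPolynomial (Fin d) k)]
    -- the order of `G` is not divisible by `p`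
    (hord : ¬ p ∣ Fintype.card G)
    -- the action of `G` on `S` is induced by a linear action on `V = ⟨x_1, …, x_d⟩`
    (hlin : ∀ (g : G) (j : Fin d),
      g • (X j : MvPolynomial (Fin d) k) ∈ Submodule.span k (Set.range X))
    -- `G ⊆ GL(V)`: the action is faithful
    (hfaithful : ∀ g : G, (∀ s : MvPolynomial (Fin d) k, g • s = s) → g = 1)
    (M : Type) [AddCommGroup M] [Module (MvPolynomial (Fin d) k) M]
    [DistribMulAction G M]
    -- the `G`-action on `M` is compatible with the `G`-action on `S`
    (hcompat : ∀ (g : G) (s : MvPolynomial (Fin d) k) (m : M), g • (s • m) = (g • s) • (g • m))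
    -- `M` is finitely generated and reflexive over `S`
    [Module.Finite (MvPolynomial (Fin d) k) M]
    [Module.IsReflexive (MvPolynomial (Fin d) k) M] :
    Module.Finite (invariantSubalgebra k d G) (fixedSubmodule k d G M hcompat) ∧
    Module.IsReflexive (invariantSubalgebra k d G) (fixedSubmodule k d G M hcompat) := by
  classical
  have hcard : (Fintype.card G : k) ≠ 0 := by
    rw [Ne, CharP.cast_eq_zero_iff k p]
    exact hord
  have hinj : Function.Injective
      (algebraMap (invariantSubalgebra k d G) (MvPolynomial (Fin d) k)) := Subtype.val_injective
  have : SMulCommClass G (invariantSubalgebra k d G) (MvPolynomial (Fin d) k) := ⟨by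
    intro g r s
    change g • ((r : MvPolynomial (Fin d) k) * s) = (r : MvPolynomial (Fin d) k) * g • s
    rw [smul_mul', r.2 g]⟩
  have : Algebra.IsInvariant (invariantSubalgebra k d G) (MvPolynomial (Fin d) k) G :=
    ⟨fun b hb => ⟨⟨b, hb⟩, rfl⟩⟩
  have : Algebra.IsIntegral (invariantSubalgebra k d G) (MvPolynomial (Fin d) k) :=
    Algebra.IsInvariant.isIntegral _ _ G
  have : Algebra.FiniteType (invariantSubalgebra k d G) (MvPolynomial (Fin d) k) :=
    Algebra.FiniteType.of_restrictScalars_finiteType k _ _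
  have : Module.Finite (invariantSubalgebra k d G) (MvPolynomial (Fin d) k) :=
    Algebra.IsIntegral.finite
  have : IsNoetherianRing (invariantSubalgebra k d G) := by
    have hfg : (⊤ : Subalgebra k (invariantSubalgebra k d G)).FG :=
      fg_of_fg_of_fg k (invariantSubalgebra k d G) (MvPolynomial (Fin d) k)
        (Algebra.FiniteType.out) (Module.Finite.fg_top) hinj
    have : Algebra.FiniteType k (invariantSubalgebra k d G) := ⟨hfg⟩
    exact Algebra.FiniteType.isNoetherianRing k _
  have : IsScalarTower (invariantSubalgebra k d G) (MvPolynomial (Fin d) k) M := inferInstance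
  have : Module.Finite (invariantSubalgebra k d G) M :=
    Module.Finite.trans (MvPolynomial (Fin d) k) M
  have hsmulM : ∀ (r : invariantSubalgebra k d G) (m : M),
    r • m = (r : MvPolynomial (Fin d) k) • m := fun _ _ => rfl
  let τ : MvPolynomial (Fin d) k →ₗ[invariantSubalgebra k d G] invariantSubalgebra k d G :=
    { toFun := fun s => ⟨∑ g : G, g • s, fun h => aux_sum h _⟩
      map_add' := by
        intro x y
        apply Subtype.ext
        simp [Finset.sum_add_distrib]
      map_smul' := by
        intro r x
        apply Subtype.ext
        simp only [RingHom.id_apply, smul_comm _ r x]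
        exact Finset.smul_sum.symm }
  have hτ : τ ≠ 0 := by
    intro h
    have h1 := congrArg Subtype.val (LinearMap.congr_fun h 1)
    change ∑ g : G, g • (1 : MvPolynomial (Fin d) k) = 0 at h1
    simp only [smul_one, Finset.sum_const, Finset.card_univ, nsmul_eq_mul, mul_one] at h1
    rw [← map_natCast (C : k →+* MvPolynomial (Fin d) k), C_eq_zero] at h1
    exact hcard h1
  obtain ⟨h0, hex, hun⟩ := aux_gen G hinj τ hτ
  have : Module.IsReflexive (invariantSubalgebra k d G) M := aux_reflexive h0 hex hun M
  let c : invariantSubalgebra k d G := algebraMap k _ ((Fintype.card G : k)⁻¹)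
  have hc : c * (Fintype.card G : invariantSubalgebra k d G) = 1 := by
    rw [← map_natCast (algebraMap k (invariantSubalgebra k d G)), ← map_mul,
      inv_mul_cancel₀ hcard, map_one]
  let ρ : M →ₗ[invariantSubalgebra k d G] fixedSubmodule k d G M hcompat :=
    { toFun := fun m => c • (⟨∑ g : G, g • m, fun h => aux_sum h _⟩ : fixedSubmodule k d G M hcompat)
      map_add' := by
        intro x y
        rw [← smul_add]
        congr 1
        apply Subtype.ext
        simp [Finset.sum_add_distrib]
      map_smul' := by
        intro r x
        rw [RingHom.id_apply, smul_comm r c]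
        congr 1
        apply Subtype.ext
        have h2 : ∀ g : G, g • (r • x) = r • (g • x) := by
          intro g
          rw [hsmulM, hcompat, r.2 g, hsmulM]
        simp only [h2]
        exact Finset.smul_sum.symm }
  have hρ : ρ ∘ₗ (fixedSubmodule k d G M hcompat).subtype = LinearMap.id := by
    ext m
    change c • (∑ g : G, g • (m : M)) = (m : M)
    have h3 : ∀ g : G, g • (m : M) = m := m.2
    simp only [h3, Finset.sum_const, Finset.card_univ]
    rw [← Nat.cast_smul_eq_nsmul (invariantSubalgebra k d G), smul_smul, hc, one_smul]
  exact ⟨inferInstance, Module.IsReflexive.of_split _ ρ hρ⟩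
end

section
/- Let M be a finitely generated S-module which is reflexive over S, equipped with an action of G by additive automorphisms satisfying g • (s · m) = (g s) · (g • m) for all g ∈ G, s ∈ S, m ∈ M. Let a : S ⊗_R M^G → M be the S-linear map a(s ⊗ m) = s · m, let λ_M : M → M^{**} be the canonical evaluation into the double S-dual (an isomorphism since M is reflexive), and let ε : (S ⊗_R M^G)^{**} → M be the composite λ_M^{-1} ∘ a^{**}. Then ε is an isomorphism of S-modules. -/
/-!
Setting: `k` algebraically closed of characteristic `p > 0`, `S = k[x_1, …, x_d]`,
`G ⊆ GL(V)` finite with `p ∤ |G|` and no pseudo-reflections, acting on `S` by `k`-algebra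
automorphisms induced by a linear action on `V = ⟨x_1, …, x_d⟩`; `R = S^G`.
If `M` is a finitely generated reflexive `S`-module with a compatible `G`-action
(`g • (s · m) = (g s) · (g • m)`), then the counit
`ε := λ_M⁻¹ ∘ a^{**} : (S ⊗_R M^G)^{**} → M` is an isomorphism of `S`-modules, where
`a : S ⊗_R M^G → M, s ⊗ m ↦ s · m`, `(-)^*` is the `S`-dual `Hom_S(-, S)`, and
`λ_M : M ≅ M^{**}` is the canonical evaluation.
-/

set_option linter.unusedSectionVars false
set_option synthInstance.maxHeartbeats 1000000
set_option maxHeartbeats 1600000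

open MvPolynomial

open scoped TensorProduct

section Aux

theorem aux_ext {S P M : Type*} [CommRing S] [IsDomain S] [AddCommGroup P] [Module S P]
    [AddCommGroup M] [Module S M] (a : P →ₗ[S] M) (φ : P →ₗ[S] S) (C : Set S)
    (hD : ∀ z y : S, (∀ c ∈ C, z ∣ c * y) → z ∣ y) (c0 : S) (hc0 : c0 ∈ C) (hne : c0 ≠ 0)
    (hC : ∀ c ∈ C, ∀ m, ∃ q, a q = c • m) (hker : ∀ q, a q = 0 → φ q = 0) :
    ∃ F : M →ₗ[S] S, F ∘ₗ a = φ := by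
  have hker' : ∀ q q', a q = a q' → φ q = φ q' := by
    intro q q' h
    have := hker (q - q') (by rw [map_sub, h, sub_self])
    rwa [map_sub, sub_eq_zero] at this
  have key : ∀ m, ∃ y : S, ∀ q, a q = c0 • m → φ q = c0 * y := by
    intro m
    obtain ⟨q0, h0⟩ := hC c0 hc0 m
    have : c0 ∣ φ q0 := by
      apply hD
      intro c hc
      obtain ⟨q, hq⟩ := hC c hc m
      refine ⟨φ q, ?_⟩
      have := hker' (c • q0) (c0 • q) (by
        rw [map_smul, map_smul, h0, hq, smul_smul, smul_smul, mul_comm])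
      simpa using this
    obtain ⟨y, hy⟩ := this
    exact ⟨y, fun q hq => by rw [hker' q q0 (hq.trans h0.symm), hy]⟩
  choose F hF using key
  refine ⟨{ toFun := F, map_add' := ?_, map_smul' := ?_ }, ?_⟩
  · intro m n
    obtain ⟨q, hq⟩ := hC c0 hc0 m
    obtain ⟨r, hr⟩ := hC c0 hc0 n
    apply mul_left_cancel₀ hne
    rw [← hF (m + n) (q + r) (by rw [map_add, hq, hr, smul_add]), map_add, hF m q hq, hF n r hr]
    ring
  · intro s m
    obtain ⟨q, hq⟩ := hC c0 hc0 m
    apply mul_left_cancel₀ hne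
    rw [← hF (s • m) (s • q) (by rw [map_smul, hq, smul_comm]), map_smul, hF m q hq]
    simp only [smul_eq_mul, RingHom.id_apply]
    ring
  · ext q
    apply mul_left_cancel₀ hne
    have := hF (a q) (c0 • q) (by rw [map_smul])
    rw [map_smul, smul_eq_mul] at this
    simpa using this.symm

theorem aux_prod {S H : Type*} [CommRing S] [DecidableEq H] (T : Finset H) (w : H → Bool → S)
    (hw : ∀ h ∈ T, ∀ z y : S, (∀ b, z ∣ w h b * y) → z ∣ y) (z y : S)
    (hz : ∀ b : H → Bool, z ∣ (∏ h ∈ T, w h (b h)) * y) : z ∣ y := by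
  induction T using Finset.induction_on generalizing y with
  | empty => simpa using hz
  | insert a T ha ih =>
    apply hw a (Finset.mem_insert_self a T)
    intro β
    apply ih (fun h hh => hw h (Finset.mem_insert_of_mem hh))
    intro b
    have := hz (Function.update b a β)
    rw [Finset.prod_insert ha, Function.update_self] at this
    have e : ∏ h ∈ T, w h (Function.update b a β h) = ∏ h ∈ T, w h (b h) := by
      apply Finset.prod_congr rfl
      intro h hh
      rw [Function.update_of_ne]
      rintro rfl
      exact ha hh
    rw [e] at this
    convert this using 1
    ring

theorem aux_fam {S G : Type} [CommRing S] [Group G] [MulSemiringAction G S] [DecidableEq G]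
    (T : Finset G) (u : G → S) :
    ∃ (ι : Type) (_ : Fintype ι) (t s : ι → S), ∀ g : G,
      ∑ i, t i * g • s i = ∏ h ∈ T, (h • u h - g • u h) := by
  induction T using Finset.induction_on with
  | empty => exact ⟨Unit, inferInstance, fun _ => 1, fun _ => 1, fun g => by simp⟩
  | insert a T ha ih =>
    obtain ⟨ι, hι, t, s, h⟩ := ih
    refine ⟨ι ⊕ ι, inferInstance, Sum.elim (fun i => a • u a * t i) (fun i => - t i),
      Sum.elim s (fun i => u a * s i), fun g => ?_⟩
    rw [Finset.prod_insert ha, ← h g, Fintype.sum_sum_type, sub_mul, Finset.mul_sum, Finset.mul_sum,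
      sub_eq_add_neg, ← Finset.sum_neg_distrib]
    congr 1
    · exact Finset.sum_congr rfl fun i _ => by simp [mul_assoc]
    · exact Finset.sum_congr rfl fun i _ => by simp [smul_mul']; ring

theorem aux_irr {k : Type} [Field k] {d : ℕ} (l : MvPolynomial (Fin d) k)
    (hl : l.totalDegree = 1) : Irreducible l := by
  have hunit : ∀ a : MvPolynomial (Fin d) k, a ≠ 0 → a.totalDegree = 0 → IsUnit a := by
    intro a ha h
    rw [totalDegree_eq_zero_iff_eq_C] at h
    rw [h]
    apply IsUnit.map
    rw [isUnit_iff_ne_zero]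
    intro h0
    rw [h0, C_0] at h
    exact ha h
  have hl0 : l ≠ 0 := by rintro rfl; simp at hl
  constructor
  · intro h
    rw [MvPolynomial.isUnit_iff_eq_C_of_isReduced] at h
    obtain ⟨r, _, rfl⟩ := h
    simp at hl
  · intro a b hab
    have ha : a ≠ 0 := by rintro rfl; simp at hab; exact hl0 hab
    have hb : b ≠ 0 := by rintro rfl; simp at hab; exact hl0 hab
    have := totalDegree_mul_of_isDomain ha hb
    rw [← hab, hl] at this
    have : a.totalDegree = 0 ∨ b.totalDegree = 0 := by omega
    exact this.imp (hunit a ha) (hunit b hb)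

theorem aux_relprime {k : Type} [Field k] {d : ℕ} (l l' : MvPolynomial (Fin d) k)
    (hl : l ∈ Submodule.span k (Set.range (X : Fin d → MvPolynomial (Fin d) k)))
    (hl' : l' ∈ Submodule.span k (Set.range (X : Fin d → MvPolynomial (Fin d) k)))
    (h0 : l ≠ 0) (hli : l' ∉ Submodule.span k {l}) (z y : MvPolynomial (Fin d) k)
    (h1 : z ∣ l * y) (h2 : z ∣ l' * y) : z ∣ y := by
  have hsub : Submodule.span k (Set.range (X : Fin d → MvPolynomial (Fin d) k)) ≤
      homogeneousSubmodule (Fin d) k 1 := by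
    rw [Submodule.span_le]
    rintro _ ⟨i, rfl⟩
    exact isHomogeneous_X k i
  have h0' : l' ≠ 0 := by rintro rfl; exact hli (Submodule.zero_mem _)
  have d1 : l.totalDegree = 1 := IsHomogeneous.totalDegree (hsub hl) h0
  have d2 : l'.totalDegree = 1 := IsHomogeneous.totalDegree (hsub hl') h0'
  have hrel : IsRelPrime l l' := by
    rw [(aux_irr l d1).isRelPrime_iff_not_dvd]
    rintro ⟨c, rfl⟩
    have hc : c ≠ 0 := by rintro rfl; simp at h0'
    rw [totalDegree_mul_of_isDomain h0 hc, d1] at d2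
    have : c.totalDegree = 0 := by omega
    rw [totalDegree_eq_zero_iff_eq_C] at this
    apply hli
    rw [this, Submodule.mem_span_singleton]
    exact ⟨coeff 0 c, by rw [smul_eq_C_mul, mul_comm]⟩
  -- l ∣ q where l*y = z*q
  obtain ⟨q, hq⟩ := h1
  obtain ⟨r, hr⟩ := h2
  by_cases hz : z = 0
  · subst hz
    rw [zero_mul] at hq
    rw [(mul_eq_zero.1 hq).resolve_left h0]
  have e : l' * q = l * r := by
    apply mul_left_cancel₀ hz
    linear_combination -l' * hq + l * hr
  have : l ∣ q := hrel.dvd_of_dvd_mul_left ⟨r, e⟩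
  obtain ⟨q', rfl⟩ := this
  exact ⟨q', mul_left_cancel₀ h0 (by rw [hq]; ring)⟩

theorem aux_pair {k : Type} [Field k] {d : ℕ} {G : Type} [Group G]
    [MulSemiringAction G (MvPolynomial (Fin d) k)]
    [SMulCommClass G k (MvPolynomial (Fin d) k)]
    (hlin : ∀ (g : G) (j : Fin d),
      g • (X j : MvPolynomial (Fin d) k) ∈ Submodule.span k (Set.range X))
    (hfaithful : ∀ g : G, (∀ s : MvPolynomial (Fin d) k, g • s = s) → g = 1)
    (g : G) (hg : g ≠ 1) (hps : Module.finrank k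
      (Submodule.span k (Set.range fun j : Fin d =>
        g • (X j : MvPolynomial (Fin d) k) - X j)) ≠ 1) :
    ∃ v : Bool → MvPolynomial (Fin d) k, (∀ b, g • v b - v b ≠ 0) ∧
      ∀ z y : MvPolynomial (Fin d) k, (∀ b, z ∣ (g • v b - v b) * y) → z ∣ y := by
  have hmem : ∀ j, g • (X j : MvPolynomial (Fin d) k) - X j ∈
      Submodule.span k (Set.range (X : Fin d → MvPolynomial (Fin d) k)) := fun j =>
    Submodule.sub_mem _ (hlin g j) (Submodule.subset_span ⟨j, rfl⟩)
  have h1 : ∃ j, g • (X j : MvPolynomial (Fin d) k) - X j ≠ 0 := by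
    by_contra! h
    apply hg
    apply hfaithful
    intro s
    induction s using MvPolynomial.induction_on with
    | C a => rw [← algebraMap_eq, Algebra.algebraMap_eq_smul_one, smul_comm, smul_one]
    | add p q hp hq => rw [smul_add, hp, hq]
    | mul_X p i hp => rw [smul_mul', hp, sub_eq_zero.1 (h i)]
  obtain ⟨j, hj⟩ := h1
  have h2 : ∃ j', g • (X j' : MvPolynomial (Fin d) k) - X j' ∉
      Submodule.span k {g • (X j : MvPolynomial (Fin d) k) - X j} := by
    by_contra! h
    apply hps
    have : Submodule.span k (Set.range fun j : Fin d =>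
        g • (X j : MvPolynomial (Fin d) k) - X j) =
        Submodule.span k {g • (X j : MvPolynomial (Fin d) k) - X j} := by
      apply le_antisymm
      · rw [Submodule.span_le]
        rintro _ ⟨i, rfl⟩
        exact h i
      · rw [Submodule.span_le, Set.singleton_subset_iff]
        exact Submodule.subset_span ⟨j, rfl⟩
    rw [this]
    exact finrank_span_singleton hj
  obtain ⟨j', hj'⟩ := h2
  refine ⟨fun b => if b then X j else X j', ?_, ?_⟩
  · intro b
    cases b
    · simp only [Bool.false_eq_true, if_false]
      intro h
      rw [h] at hj'
      exact hj' (Submodule.zero_mem _)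
    · simpa using hj
  · intro z y h
    exact aux_relprime _ _ (hmem j) (hmem j') hj hj' z y (by simpa using h true)
      (by simpa using h false)

end Aux

theorem counit_bijective
    (k : Type) [Field k] [IsAlgClosed k] (p : ℕ) [Fact p.Prime] [CharP k p]
    (d : ℕ) (G : Type) [Group G] [Fintype G]
    [MulSemiringAction G (MvPolynomial (Fin d) k)]
    [SMulCommClass G k (MvPolynomial (Fin d) k)]
    -- the order of `G` is not divisible by `p`
    (hord : ¬ p ∣ Fintype.card G)
    -- the action of `G` on `S` is induced by a linear action on `V = ⟨x_1, …, x_d⟩`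
    (hlin : ∀ (g : G) (j : Fin d),
      g • (X j : MvPolynomial (Fin d) k) ∈ Submodule.span k (Set.range X))
    -- `G ⊆ GL(V)`: the action is faithful
    (hfaithful : ∀ g : G, (∀ s : MvPolynomial (Fin d) k, g • s = s) → g = 1)
    -- `G` contains no pseudo-reflections
    (hps : ∀ g : G, g ≠ 1 → Module.finrank k
      (Submodule.span k (Set.range fun j : Fin d =>
        g • (X j : MvPolynomial (Fin d) k) - X j)) ≠ 1)
    (M : Type) [AddCommGroup M] [Module (MvPolynomial (Fin d) k) M]
    [DistribMulAction G M]
    -- the `G`-action on `M` is compatible with the `G`-action on `S`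
    (hcompat : ∀ (g : G) (s : MvPolynomial (Fin d) k) (m : M), g • (s • m) = (g • s) • (g • m))
    -- `M` is finitely generated and reflexive over `S`
    [Module.Finite (MvPolynomial (Fin d) k) M]
    [Module.IsReflexive (MvPolynomial (Fin d) k) M] :
    -- `a : S ⊗_R M^G → M` is the `S`-linear map with `a (s ⊗ m) = s • m`, and the composite
    -- `ε = λ_M⁻¹ ∘ a^{**} : (S ⊗_R M^G)^{**} → M` is bijective
    Function.Bijective
      ((Module.evalEquiv (MvPolynomial (Fin d) k) M).symm.toLinearMap ∘ₗ
        (LinearMap.liftBaseChange (MvPolynomial (Fin d) k)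
          (fixedSubmodule k d G M hcompat).subtype).dualMap.dualMap) := by
  classical
  set a := (LinearMap.liftBaseChange (MvPolynomial (Fin d) k)
          (fixedSubmodule k d G M hcompat).subtype) with ha
  suffices hb : Function.Bijective a.dualMap by
    have e : a.dualMap.dualMap = (LinearEquiv.ofBijective _ hb).dualMap.toLinearMap := by
      ext; rfl
    rw [e, LinearMap.coe_comp]
    exact (LinearEquiv.bijective _).comp (LinearEquiv.bijective _)
  have hv := fun g : G => fun hg : g ≠ 1 => aux_pair hlin hfaithful g hg (hps g hg)
  choose! v hv0 hvd using hv
  set T : Finset G := Finset.univ.erase 1 with hT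
  let c : (G → Bool) → MvPolynomial (Fin d) k := fun b => ∏ h ∈ T, (h • v h (b h) - v h (b h))
  have hcne : ∀ b, c b ≠ 0 := fun b =>
    Finset.prod_ne_zero_iff.2 fun h hh => hv0 h (Finset.ne_of_mem_erase hh) _
  -- the trace
  let tr : M →+ fixedSubmodule k d G M hcompat :=
    { toFun := fun m => ⟨∑ g : G, g • m, fun g' => by
        rw [Finset.smul_sum]
        simp_rw [smul_smul]
        exact Fintype.sum_equiv (Equiv.mulLeft g') _ _ fun g => rfl⟩
      map_zero' := by ext; simp
      map_add' := fun m n => by ext; simp [Finset.sum_add_distrib] }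
  have htr : ∀ m, ((tr m : fixedSubmodule k d G M hcompat) : M) = ∑ g : G, g • m := fun m => rfl
  have hfam : ∀ b, ∃ (ι : Type) (_ : Fintype ι) (t s : ι → MvPolynomial (Fin d) k), ∀ g : G,
      ∑ i, t i * g • s i = if g = 1 then c b else 0 := by
    intro b
    obtain ⟨ι, hι, t, s, h⟩ := aux_fam T (fun h => v h (b h))
    refine ⟨ι, hι, t, s, fun g => ?_⟩
    rw [h]
    split_ifs with hg
    · subst hg; simp [c]
    · exact Finset.prod_eq_zero (Finset.mem_erase.2 ⟨hg, Finset.mem_univ g⟩) (sub_self _)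
  have hatmul : ∀ (s : MvPolynomial (Fin d) k) (n : fixedSubmodule k d G M hcompat),
      a (s ⊗ₜ[invariantSubalgebra k d G] n) = s • (n : M) := fun s n => by
    rw [ha, LinearMap.liftBaseChange_tmul]; rfl
  have hC : ∀ b m, ∃ q, a q = c b • m := by
    intro b m
    obtain ⟨ι, hι, t, s, h⟩ := hfam b
    refine ⟨∑ i, t i ⊗ₜ[invariantSubalgebra k d G] tr (s i • m), ?_⟩
    rw [map_sum]
    simp_rw [hatmul, htr, Finset.smul_sum, hcompat, smul_smul]
    rw [Finset.sum_comm]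
    simp_rw [← Finset.sum_smul, h]
    simp
  constructor
  · intro F F' hF
    ext m
    obtain ⟨q, hq⟩ := hC (fun _ => true) m
    have := LinearMap.congr_fun hF q
    simp only [LinearMap.dualMap_apply, hq, map_smul, smul_eq_mul] at this
    rw [mul_left_cancel₀ (hcne _) this]
  · intro φ
    have hker : ∀ q, a q = 0 → φ q = 0 := by
      intro q hq
      obtain ⟨ι, hι, t, s, h⟩ := hfam (fun _ => true)
      have key : ∑ i, t i * φ (1 ⊗ₜ[invariantSubalgebra k d G] tr (s i • a q)) = c (fun _ => true) * φ q := by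
        clear hq
        induction q using TensorProduct.induction_on with
        | zero => simp
        | add x y hx hy =>
          simp only [map_add, smul_add, TensorProduct.tmul_add, mul_add, Finset.sum_add_distrib,
            hx, hy]
        | tmul x n =>
          have e1 : φ (x ⊗ₜ[invariantSubalgebra k d G] n) = x * φ (1 ⊗ₜ[invariantSubalgebra k d G] n) := by
            rw [← smul_eq_mul, ← map_smul, TensorProduct.smul_tmul', smul_eq_mul, mul_one]
          have e2 : ∀ y : MvPolynomial (Fin d) k,
              φ (1 ⊗ₜ[invariantSubalgebra k d G] tr (y • (n : M))) = (∑ g : G, g • y) * φ (1 ⊗ₜ[invariantSubalgebra k d G] n) := by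
            intro y
            let r : invariantSubalgebra k d G := ⟨∑ g : G, g • y, fun g' => by
              rw [Finset.smul_sum]
              simp_rw [smul_smul]
              exact Fintype.sum_equiv (Equiv.mulLeft g') _ _ fun g => rfl⟩
            have er : tr (y • (n : M)) = r • n := by
              ext
              rw [htr]
              simp_rw [hcompat]
              have : ∀ g : G, g • (n : M) = n := n.2
              simp_rw [this, ← Finset.sum_smul]
              rfl
            rw [er, ← TensorProduct.smul_tmul]
            have : r • (1 : MvPolynomial (Fin d) k) = (∑ g : G, g • y) * 1 := rfl
            rw [this, ← smul_eq_mul, ← TensorProduct.smul_tmul', map_smul, smul_eq_mul]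
          simp_rw [hatmul, smul_smul, e2, e1, ← mul_assoc, ← Finset.sum_mul]
          congr 1
          simp_rw [Finset.mul_sum, smul_mul', ← mul_assoc]
          rw [Finset.sum_comm]
          simp_rw [← Finset.sum_mul, h]
          simp
      rw [hq] at key
      simp only [smul_zero, map_zero, TensorProduct.tmul_zero, mul_zero, Finset.sum_const_zero]
        at key
      exact (mul_eq_zero.1 key.symm).resolve_left (hcne _)
    obtain ⟨F, hF⟩ := aux_ext a φ (Set.range c) (by
        intro z y hz
        refine aux_prod T (fun h β => h • v h β - v h β)
          (fun h hh => hvd h (Finset.ne_of_mem_erase hh)) z y ?_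
        intro b
        exact hz _ ⟨b, rfl⟩) (c fun _ => true) ⟨_, rfl⟩ (hcne _)
      (by rintro _ ⟨b, rfl⟩; exact hC b) hker
    exact ⟨F, hF⟩
end
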